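/- arXiv:1608.07424 — 2 statements merged into one kernel-verified Lean document; each statement's English description precedes it below -/
import Mathlib

section
/- For every real number t > 0 there exists a linear isomorphism g : ℝ⁶ → ℝ⁶ with g*(α^t) = α_(i). -/
/-- `dx3 i j k` is the alternating 3-form `dxⁱ ∧ dxʲ ∧ dxᵏ` on `ℝ⁶ = Fin 6 → ℝ`. -/
noncomputable def dx3 (i j k : Fin 6) : AlternatingMap ℝ (Fin 6 → ℝ) ℝ (Fin 3) :=
  (Matrix.detRowAlternating : AlternatingMap ℝ (Fin 3 → ℝ) ℝ (Fin 3)).compLinearMap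
    (LinearMap.funLeft ℝ ℝ ![i, j, k])

/-- `α^t = dx^{135} − dx^{146} − dx^{236} + t·dx^{245}` (0-based indices). -/
noncomputable def alphaT (t : ℝ) : AlternatingMap ℝ (Fin 6 → ℝ) ℝ (Fin 3) :=
  dx3 0 2 4 - dx3 0 3 5 - dx3 1 2 5 + t • dx3 1 3 4

/-- `α_(i) = dx^{123} + dx^{456}`. -/
noncomputable def alphaI : AlternatingMap ℝ (Fin 6 → ℝ) ℝ (Fin 3) :=
  dx3 0 1 2 + dx3 3 4 5

/-- `α_(ii) = dx^{135} − dx^{146} − dx^{236} − dx^{245}`. -/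
noncomputable def alphaII : AlternatingMap ℝ (Fin 6 → ℝ) ℝ (Fin 3) :=
  dx3 0 2 4 - dx3 0 3 5 - dx3 1 2 5 - dx3 1 3 4

/-- `α_(iii) = dx^{156} − dx^{246} + dx^{345}`. -/
noncomputable def alphaIII : AlternatingMap ℝ (Fin 6 → ℝ) ℝ (Fin 3) :=
  dx3 0 4 5 - dx3 1 3 5 + dx3 2 3 4

/-- Evaluation of `dxⁱ ∧ dxʲ ∧ dxᵏ` as an expanded `3 × 3` determinant. -/
lemma dx3_apply (i j k : Fin 6) (v : Fin 3 → Fin 6 → ℝ) :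
    dx3 i j k v =
      v 0 i * v 1 j * v 2 k - v 0 i * v 1 k * v 2 j - v 0 j * v 1 i * v 2 k
        + v 0 j * v 1 k * v 2 i + v 0 k * v 1 i * v 2 j - v 0 k * v 1 j * v 2 i := by
  change Matrix.det (Matrix.of fun a b => v a (![i, j, k] b)) = _
  simp [Matrix.det_fin_three]

/-- For `s ≠ 0`, the isomorphism of `ℝ⁶` that splits `x¹ ± s x²`, `x³ ± s x⁴`, `x⁵ ∓ s⁻¹ x⁶`
into separate coordinates, given through its inverse. -/
noncomputable def splitEquiv (s : ℝ) (hs : s ≠ 0) : (Fin 6 → ℝ) ≃ₗ[ℝ] (Fin 6 → ℝ) where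
  toFun y := ![y 0 + y 3, (y 0 - y 3) / s, (y 1 + y 4) / 2, (y 1 - y 4) / (2 * s),
    (y 2 + y 5) / 2, -(s * (y 2 - y 5)) / 2]
  invFun x := ![(x 0 + s * x 1) / 2, x 2 + s * x 3, x 4 - x 5 / s,
    (x 0 - s * x 1) / 2, x 2 - s * x 3, x 4 + x 5 / s]
  map_add' x y := by
    ext i
    fin_cases i <;> simp <;> ring
  map_smul' c x := by
    ext i
    fin_cases i <;> simp <;> ring
  left_inv y := by
    ext i
    fin_cases i <;> simp <;> field_simp <;> ring
  right_inv x := by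
    ext i
    fin_cases i <;> simp <;> field_simp <;> ring

lemma splitEquiv_apply (s : ℝ) (hs : s ≠ 0) (y : Fin 6 → ℝ) :
    splitEquiv s hs y = ![y 0 + y 3, (y 0 - y 3) / s, (y 1 + y 4) / 2, (y 1 - y 4) / (2 * s),
      (y 2 + y 5) / 2, -(s * (y 2 - y 5)) / 2] := rfl

lemma alphaT_sq_compLinearMap_splitEquiv (s : ℝ) (hs : s ≠ 0) :
    (alphaT (s ^ 2)).compLinearMap (splitEquiv s hs : (Fin 6 → ℝ) →ₗ[ℝ] (Fin 6 → ℝ)) =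
      alphaI := by
  ext v
  simp only [alphaT, alphaI, AlternatingMap.compLinearMap_apply, AlternatingMap.add_apply,
    AlternatingMap.sub_apply, AlternatingMap.smul_apply, smul_eq_mul, dx3_apply,
    LinearEquiv.coe_coe, splitEquiv_apply, Matrix.cons_val]
  field_simp
  ring

/-- For every `t > 0` there is a linear isomorphism `g` of `ℝ⁶` with `g*(α^t) = α_(i)`. -/
theorem alphaT_pos_type (t : ℝ) (ht : 0 < t) :
    ∃ g : (Fin 6 → ℝ) ≃ₗ[ℝ] (Fin 6 → ℝ),
      (alphaT t).compLinearMap (g : (Fin 6 → ℝ) →ₗ[ℝ] (Fin 6 → ℝ)) = alphaI := by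
  refine ⟨splitEquiv (√t) (Real.sqrt_pos.mpr ht).ne', ?_⟩
  have h := alphaT_sq_compLinearMap_splitEquiv (√t) (Real.sqrt_pos.mpr ht).ne'
  rwa [Real.sq_sqrt ht.le] at h
end

section
/- There exists a linear isomorphism g : ℝ⁶ → ℝ⁶ with g*(α⁰) = α_(iii), where α⁰ = dx^{135} − dx^{146} − dx^{236}. -/
/-- `α⁰ = dx^{135} − dx^{146} − dx^{236}`. -/
noncomputable def alphaZero : AlternatingMap ℝ (Fin 6 → ℝ) ℝ (Fin 3) :=
  dx3 0 2 4 - dx3 0 3 5 - dx3 1 2 5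

/-- The signed coordinate permutation
`(x₁, …, x₆) ↦ (x₄, -x₁, x₅, -x₂, x₃, x₆)` of `ℝ⁶`. -/
def signedCoordPerm : (Fin 6 → ℝ) ≃ₗ[ℝ] (Fin 6 → ℝ) where
  toFun v := ![v 3, -v 0, v 4, -v 1, v 2, v 5]
  invFun w := ![-w 1, -w 3, w 4, w 0, w 2, w 5]
  map_add' v w := by
    ext i
    fin_cases i <;> simp [add_comm]
  map_smul' c v := by
    ext i
    fin_cases i <;> simp
  left_inv v := by
    ext i
    fin_cases i <;> simp
  right_inv w := by
    ext i
    fin_cases i <;> simp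

theorem signedCoordPerm_apply (v : Fin 6 → ℝ) :
    signedCoordPerm v = ![v 3, -v 0, v 4, -v 1, v 2, v 5] := rfl

theorem dx3_apply_s10 (i j k : Fin 6) (v : Fin 3 → Fin 6 → ℝ) :
    dx3 i j k v = Matrix.det (Matrix.of fun a b => v a (![i, j, k] b)) := rfl

/-- There is a linear isomorphism `g` of `ℝ⁶` with `g*(α⁰) = α_(iii)`. -/
theorem alphaZero_type :
    ∃ g : (Fin 6 → ℝ) ≃ₗ[ℝ] (Fin 6 → ℝ),
      alphaZero.compLinearMap (g : (Fin 6 → ℝ) →ₗ[ℝ] (Fin 6 → ℝ)) = alphaIII := by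
  refine ⟨signedCoordPerm, ?_⟩
  ext v
  simp [alphaZero, alphaIII, dx3_apply_s10, Matrix.det_fin_three, signedCoordPerm_apply]
  ring
end
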